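/- If Φ₁, Φ₂ ∈ 𝔉H, then the Schur idempotent Φ₁∘Φ₂ (whose range is ran Φ₁ ∩ ran Φ₂) belongs to 𝔉H, and λ(Φ₁∘Φ₂) ≤ λ(Φ₁) + λ(Φ₂)·‖Φ₁‖. -/

import Mathlib

open scoped InnerProductSpace Pointwise

noncomputable section

namespace SchurHyper

/-- `B H` is the algebra of bounded linear operators on `H`. -/
abbrev B (H : Type*) [NormedAddCommGroup H] [InnerProductSpace ℂ H] : Type _ := H →L[ℂ] H

variable (H : Type*) [NormedAddCommGroup H] [InnerProductSpace ℂ H]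

/-- A linear functional on `B H` is *normal* (weak* continuous) if it arises from
the duality with the trace class, i.e. it is of the form
`T ↦ ∑ₙ ⟪yₙ, T xₙ⟫` for square-summable sequences `(xₙ)`, `(yₙ)`
(recall that the inner product is conjugate-linear in its first slot). -/
def IsNormalFunctional (ω : B H →ₗ[ℂ] ℂ) : Prop :=
  ∃ x y : ℕ → H, Summable (fun n => ‖x n‖ ^ 2) ∧ Summable (fun n => ‖y n‖ ^ 2) ∧
    ∀ T : B H, ω T = ∑' n, ⟪y n, T (x n)⟫_ℂ

/-- The weak* topology on `B H`: the topology induced by the normal functionals. -/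
def weakStarTopology : TopologicalSpace (B H) :=
  TopologicalSpace.induced
    (fun (T : B H) (ω : {ω : B H →ₗ[ℂ] ℂ // IsNormalFunctional H ω}) => ω.1 T)
    inferInstance

/-- A set of operators is weak* closed if it is closed in the weak* topology. -/
def WStarClosed (X : Set (B H)) : Prop := @IsClosed _ (weakStarTopology H) X

/-- The weak* closure of a set of operators. -/
def wStarClosure (X : Set (B H)) : Set (B H) := @closure _ (weakStarTopology H) X

/-- A map on `B H` is weak* continuous if it is continuous with respect to the
weak* topology on both sides. -/
def WStarContinuous (Φ : B H →L[ℂ] B H) : Prop :=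
  @Continuous _ _ (weakStarTopology H) (weakStarTopology H) Φ

variable {H}
variable [CompleteSpace H]

/-- A maximal abelian selfadjoint subalgebra of `B H`: an abelian selfadjoint
subalgebra which contains every operator commuting with it (equivalently, it
coincides with its own commutant). -/
def IsMasa (D : StarSubalgebra ℂ (B H)) : Prop :=
  (∀ A ∈ D, ∀ C ∈ D, A * C = C * A) ∧
  (∀ T : B H, (∀ A ∈ D, T * A = A * T) → T ∈ D)

/-- A Schur multiplier: a weak* continuous `D`-bimodule map on `B H`. -/
def IsSchurMultiplier (D : StarSubalgebra ℂ (B H)) (Φ : B H →L[ℂ] B H) : Prop :=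
  WStarContinuous H Φ ∧ ∀ A ∈ D, ∀ C ∈ D, ∀ T : B H, Φ (A * T * C) = A * Φ T * C

/-- A Schur idempotent: an idempotent Schur multiplier. -/
def IsSchurIdempotent (D : StarSubalgebra ℂ (B H)) (Φ : B H →L[ℂ] B H) : Prop :=
  IsSchurMultiplier D Φ ∧ Φ.comp Φ = Φ

/-- A subspace `X ⊆ B H` is a `D`-bimodule if `D X D ⊆ X`. -/
def IsBimodule (D : StarSubalgebra ℂ (B H)) (X : Submodule ℂ (B H)) : Prop :=
  ∀ A ∈ D, ∀ C ∈ D, ∀ T ∈ X, A * T * C ∈ X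

/-- The Arveson distance `α(T, X)`. -/
def arveson (T : B H) (X : Set (B H)) : ℝ :=
  ⨆ ξ : {ξ : H // ‖ξ‖ = 1}, ⨅ S : X, ‖T ξ.1 - S.1 ξ.1‖

/-- The set of hyperreflexivity constants of `X`. -/
def hyperSet (X : Set (B H)) : Set ℝ :=
  {k | 0 < k ∧ ∀ T : B H, Metric.infDist T X ≤ k * arveson T X}

/-- A subspace is hyperreflexive if `d(T, X) ≤ k ⬝ α(T, X)` for some `k > 0`. -/
def Hyperreflexive (X : Set (B H)) : Prop := (hyperSet X).Nonempty

/-- The hyperreflexivity constant `k(X)`: the least constant that works. -/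
def hyperConst (X : Set (B H)) : ℝ := sInf (hyperSet X)

/-- The set of constants `λ` witnessing that a Schur idempotent lies in `𝔉H`. -/
def lamSet (Φ : B H →L[ℂ] B H) : Set ℝ :=
  {l | 0 < l ∧ ∀ T : B H, ‖T - Φ T‖ ≤ l * arveson T (Set.range Φ)}

/-- The class `𝔉H` of Schur idempotents `Φ` such that
`‖T - Φ T‖ ≤ λ ⬝ α(T, ran Φ)` for some `λ > 0` and all `T`. -/
def MemFH (D : StarSubalgebra ℂ (B H)) (Φ : B H →L[ℂ] B H) : Prop :=
  IsSchurIdempotent D Φ ∧ (lamSet Φ).Nonempty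

/-- The constant `λ(Φ)`: the least constant witnessing membership of `𝔉H`. -/
def lam (Φ : B H →L[ℂ] B H) : ℝ := sInf (lamSet Φ)

/-- A ternary masa-bimodule condition: `S T* R ∈ M` whenever `S, T, R ∈ M`. -/
def IsTernary (M : Submodule ℂ (B H)) : Prop :=
  ∀ S ∈ M, ∀ T ∈ M, ∀ R ∈ M, S * star T * R ∈ M

end SchurHyper

open SchurHyper

namespace SchurHyper

open Filter Topology InnerProductSpace

section

variable {H : Type*} [NormedAddCommGroup H] [InnerProductSpace ℂ H]

/-- A functional on `B H` given by an absolutely convergent trace-class series over an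
arbitrary index type. -/
def HasTraceRep (ω : B H → ℂ) : Prop :=
  ∃ (ι : Type) (x y : ι → H), Summable (fun i => ‖y i‖ * ‖x i‖) ∧
    ∀ T : B H, ω T = ∑' i, ⟪y i, T (x i)⟫_ℂ

lemma norm_inner_apply_le (T : B H) (x y : H) :
    ‖⟪y, T x⟫_ℂ‖ ≤ ‖T‖ * (‖y‖ * ‖x‖) :=
  calc ‖⟪y, T x⟫_ℂ‖ ≤ ‖y‖ * ‖T x‖ := norm_inner_le_norm _ _
    _ ≤ ‖y‖ * (‖T‖ * ‖x‖) := by gcongr; exact T.le_opNorm x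
    _ = ‖T‖ * (‖y‖ * ‖x‖) := by ring

lemma summable_inner_apply {ι : Type*} {x y : ι → H}
    (h : Summable fun i => ‖y i‖ * ‖x i‖) (T : B H) :
    Summable fun i => ⟪y i, T (x i)⟫_ℂ :=
  Summable.of_norm_bounded (h.mul_left ‖T‖) fun _ => norm_inner_apply_le _ _ _

lemma IsNormalFunctional.hasTraceRep {ω : B H →ₗ[ℂ] ℂ} (h : IsNormalFunctional H ω) :
    HasTraceRep ω := by
  obtain ⟨x, y, hx, hy, hω⟩ := h
  refine ⟨ℕ, x, y, Summable.of_nonneg_of_le (fun _ => by positivity) (fun n => ?_) (hx.add hy), hω⟩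
  nlinarith [sq_nonneg (‖x n‖ - ‖y n‖), sq_nonneg ‖x n‖, sq_nonneg ‖y n‖]

lemma HasTraceRep.zero : HasTraceRep (fun _ : B H => (0 : ℂ)) :=
  ⟨Empty, Empty.elim, Empty.elim, summable_empty, fun _ => by simp⟩

lemma HasTraceRep.add {ω ω' : B H → ℂ} (h : HasTraceRep ω) (h' : HasTraceRep ω') :
    HasTraceRep (fun T => ω T + ω' T) := by
  obtain ⟨ι, x, y, hs, hω⟩ := h
  obtain ⟨κ, x', y', hs', hω'⟩ := h'
  refine ⟨ι ⊕ κ, Sum.elim x x', Sum.elim y y', Summable.sum _ hs hs', fun T => ?_⟩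
  simp only [hω, hω']
  exact (Summable.tsum_sum (f := fun i => ⟪Sum.elim y y' i, T (Sum.elim x x' i)⟫_ℂ)
    (summable_inner_apply hs T) (summable_inner_apply hs' T)).symm

lemma HasTraceRep.const_mul {ω : B H → ℂ} (h : HasTraceRep ω) (c : ℂ) :
    HasTraceRep (fun T => c * ω T) := by
  obtain ⟨ι, x, y, hs, hω⟩ := h
  refine ⟨ι, fun i => c • x i, y, (hs.mul_left ‖c‖).congr fun i => ?_, fun T => ?_⟩
  · rw [norm_smul]; ring
  · simp only [hω, map_smul, inner_smul_right, tsum_mul_left]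

lemma isNormalFunctional_inner (u v : H) :
    IsNormalFunctional H ((innerₛₗ ℂ u) ∘ₗ (ContinuousLinearMap.apply ℂ H v).toLinearMap) := by
  refine ⟨Pi.single 0 v, Pi.single 0 u, ?_, ?_, fun T => ?_⟩
  · exact summable_of_ne_finset_zero (s := {0}) fun n hn => by
      simp [Pi.single_eq_of_ne (Finset.notMem_singleton.1 hn)]
  · exact summable_of_ne_finset_zero (s := {0}) fun n hn => by
      simp [Pi.single_eq_of_ne (Finset.notMem_singleton.1 hn)]
  · rw [tsum_eq_single 0 fun n hn => by simp [Pi.single_eq_of_ne hn]]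
    simp

/-- A weak* continuous map pulls vector functionals back to trace-class functionals. -/
lemma WStarContinuous.hasTraceRep {Φ : B H →L[ℂ] B H} (hΦ : WStarContinuous H Φ) (u v : H) :
    HasTraceRep (fun T => ⟪u, Φ T v⟫_ℂ) := by
  let f : {ω : B H →ₗ[ℂ] ℂ // IsNormalFunctional H ω} → B H →ₗ[ℂ] ℂ := fun ω => ω.1
  let ω₀ : {ω : B H →ₗ[ℂ] ℂ // IsNormalFunctional H ω} := ⟨_, isNormalFunctional_inner u v⟩
  have htop : weakStarTopology H = ⨅ ω, TopologicalSpace.induced (f ω) inferInstance := by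
    rw [weakStarTopology, induced_to_pi]
  have hmem : ω₀.1 ∘ₗ Φ.toLinearMap ∈ Submodule.span ℂ (Set.range f) := by
    rw [LinearMap.mem_span_iff_continuous, ← htop]
    have h0 : @Continuous _ _ (weakStarTopology H) _ ω₀.1 := by
      rw [htop]
      exact continuous_iInf_dom (i := ω₀) continuous_induced_dom
    exact @Continuous.comp _ _ _ (weakStarTopology H) (weakStarTopology H) _ Φ ω₀.1 h0 hΦ
  have key : ∀ φ ∈ Submodule.span ℂ (Set.range f), HasTraceRep φ := fun φ hφ => by
    induction hφ using Submodule.span_induction with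
    | mem φ h =>
      obtain ⟨ω, rfl⟩ := h
      exact ω.2.hasTraceRep
    | zero => exact HasTraceRep.zero
    | add _ _ _ _ h h' => exact h.add h'
    | smul c _ _ h => exact h.const_mul c
  exact key _ hmem

lemma WStarContinuous.comp {Φ Ψ : B H →L[ℂ] B H} (hΦ : WStarContinuous H Φ)
    (hΨ : WStarContinuous H Ψ) : WStarContinuous H (Φ.comp Ψ) :=
  @Continuous.comp _ _ _ (weakStarTopology H) (weakStarTopology H) (weakStarTopology H) Ψ Φ hΦ hΨ

lemma norm_sum_inner_smul_le {ι : Type*} {b : ι → H} (hb : Orthonormal ℂ b) (s : Finset ι)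
    (x : H) : ‖∑ i ∈ s, ⟪b i, x⟫_ℂ • b i‖ ≤ ‖x‖ := by
  have h := hb.inner_sum (fun i => ⟪b i, x⟫_ℂ) (fun i => ⟪b i, x⟫_ℂ) s
  rw [inner_self_eq_norm_sq_to_K] at h
  have h2 : ‖∑ i ∈ s, ⟪b i, x⟫_ℂ • b i‖ ^ 2 = ∑ i ∈ s, ‖⟪b i, x⟫_ℂ‖ ^ 2 := by
    simp only [RCLike.conj_mul] at h
    exact_mod_cast h
  have h3 := hb.sum_inner_products_le x (s := s)
  rw [← h2] at h3
  exact (sq_le_sq₀ (norm_nonneg _) (norm_nonneg _)).1 h3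

lemma arveson_anti {X Y : Set (B H)} (h0 : 0 ∈ X) (hXY : X ⊆ Y) (T : B H) :
    arveson T Y ≤ arveson T X := by
  have hbdd : ∀ (Z : Set (B H)) (ξ : H), BddBelow (Set.range fun S : Z => ‖T ξ - S.1 ξ‖) :=
    fun Z ξ => ⟨0, by rintro _ ⟨S, rfl⟩; exact norm_nonneg _⟩
  have : Nonempty X := ⟨⟨0, h0⟩⟩
  refine ciSup_mono ⟨‖T‖, ?_⟩ fun ξ => ?_
  · rintro _ ⟨ξ, rfl⟩
    refine (ciInf_le (hbdd X ξ.1) ⟨0, h0⟩).trans ?_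
    simpa [ξ.2] using T.le_opNorm ξ.1
  · exact le_ciInf fun S => ciInf_le (hbdd Y ξ.1) ⟨S.1, hXY S.2⟩

variable [CompleteSpace H]

/-- Every operator is approximated, for a given trace-class functional, by the finite sums
of rank-one operators coming from a Hilbert basis. -/
lemma HasTraceRep.tendsto {ω : B H → ℂ} (h : HasTraceRep ω) {ι : Type*} (b : HilbertBasis ι ℂ H)
    (T : B H) :
    Tendsto (fun s : Finset ι => ω (∑ i ∈ s, rankOne ℂ (b i) (star T (b i)))) atTop
      (𝓝 (ω T)) := by
  obtain ⟨κ, x, y, hs, hω⟩ := h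
  have happ : ∀ (s : Finset ι) (z : H), (∑ i ∈ s, rankOne ℂ (b i) (star T (b i))) z
      = ∑ i ∈ s, ⟪b i, T z⟫_ℂ • b i := fun s z => by
    simp [ContinuousLinearMap.star_eq_adjoint,
      ContinuousLinearMap.adjoint_inner_left]
  simp only [hω, happ]
  refine tendsto_tsum_of_dominated_convergence (hs.mul_left ‖T‖) (fun k => ?_)
    (Eventually.of_forall fun s k => ?_)
  · have := b.hasSum_repr (T (x k))
    simp only [b.repr_apply_apply] at this
    exact Tendsto.inner tendsto_const_nhds this
  · calc _ ≤ ‖y k‖ * ‖∑ i ∈ s, ⟪b i, T (x k)⟫_ℂ • b i‖ := norm_inner_le_norm _ _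
      _ ≤ ‖y k‖ * (‖T‖ * ‖x k‖) := by
        gcongr
        exact (norm_sum_inner_smul_le b.orthonormal s _).trans (T.le_opNorm _)
      _ = _ := by ring

/-- Weak* continuous linear maps are determined by their values on rank-one operators. -/
lemma WStarContinuous.ext_rankOne {Φ Ψ : B H →L[ℂ] B H} (hΦ : WStarContinuous H Φ)
    (hΨ : WStarContinuous H Ψ) (h : ∀ e f : H, Φ (rankOne ℂ e f) = Ψ (rankOne ℂ e f)) :
    Φ = Ψ := by
  obtain ⟨w, b, -⟩ := exists_hilbertBasis ℂ H
  refine ContinuousLinearMap.ext fun T => ContinuousLinearMap.ext fun v =>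
    ext_inner_left ℂ fun u => ?_
  refine tendsto_nhds_unique ((hΦ.hasTraceRep u v).tendsto b T) ?_
  simp only [map_sum, h]
  simpa only [map_sum] using (hΨ.hasTraceRep u v).tendsto b T

variable {D : StarSubalgebra ℂ (B H)}

/-- The closed subspace generated by `e` under the action of `D`. -/
def cyclicSubspace (D : StarSubalgebra ℂ (B H)) (e : H) : Submodule ℂ H :=
  (D.toSubalgebra.toSubmodule.map
    (ContinuousLinearMap.apply ℂ H e).toLinearMap).topologicalClosure

instance (e : H) : CompleteSpace (cyclicSubspace D e) :=
  (Submodule.isClosed_topologicalClosure _).completeSpace_coe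

lemma apply_mem_cyclicSubspace {A : B H} (hA : A ∈ D) (e : H) : A e ∈ cyclicSubspace D e :=
  Submodule.le_topologicalClosure _ ⟨A, hA, rfl⟩

lemma self_mem_cyclicSubspace (e : H) : e ∈ cyclicSubspace D e :=
  apply_mem_cyclicSubspace (one_mem D) e

lemma exists_seq_of_mem_cyclicSubspace {e v : H} (hv : v ∈ cyclicSubspace D e) :
    ∃ a : ℕ → B H, (∀ n, a n ∈ D) ∧ Tendsto (fun n => a n e) atTop (𝓝 v) := by
  obtain ⟨x, hx, hlim⟩ := mem_closure_iff_seq_limit.1 hv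
  choose a ha hax using hx
  exact ⟨a, ha, (funext hax : (fun n => a n e) = x) ▸ hlim⟩

lemma map_mem_cyclicSubspace {A : B H} (hA : A ∈ D) {e v : H} (hv : v ∈ cyclicSubspace D e) :
    A v ∈ cyclicSubspace D e := by
  obtain ⟨a, ha, hlim⟩ := exists_seq_of_mem_cyclicSubspace hv
  exact (Submodule.isClosed_topologicalClosure _).mem_of_tendsto
    ((A.continuous.tendsto v).comp hlim)
    (Eventually.of_forall fun n => apply_mem_cyclicSubspace (mul_mem hA (ha n)) e)

lemma inner_star_apply (A : B H) (u v : H) : ⟪star A u, v⟫_ℂ = ⟪u, A v⟫_ℂ := by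
  rw [ContinuousLinearMap.star_eq_adjoint, ContinuousLinearMap.adjoint_inner_left]

lemma inner_apply_star (A : B H) (u v : H) : ⟪u, star A v⟫_ℂ = ⟪A u, v⟫_ℂ := by
  rw [ContinuousLinearMap.star_eq_adjoint, ContinuousLinearMap.adjoint_inner_right]

/-- The projection onto a cyclic subspace of a masa belongs to the masa. -/
lemma IsMasa.starProjection_mem (hD : IsMasa D) (e : H) :
    (cyclicSubspace D e).starProjection ∈ D := by
  refine hD.2 _ fun A hA => ContinuousLinearMap.ext fun x => ?_
  refine Submodule.eq_starProjection_of_mem_orthogonal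
    (map_mem_cyclicSubspace hA (Submodule.starProjection_apply_mem _ x)) ?_
  change A x - A ((cyclicSubspace D e).starProjection x) ∈ _
  rw [← map_sub, Submodule.mem_orthogonal]
  intro u hu
  rw [← inner_star_apply]
  exact Submodule.inner_right_of_mem_orthogonal (map_mem_cyclicSubspace (star_mem hA) hu)
    (Submodule.sub_starProjection_mem_orthogonal x)

/-- The graph of the closure of the conjugate-linear map `a e ↦ a* e`, `a ∈ D`. -/
def ConjRel (D : StarSubalgebra ℂ (B H)) (e v w : H) : Prop :=
  ∃ a : ℕ → B H, (∀ n, a n ∈ D) ∧ Tendsto (fun n => a n e) atTop (𝓝 v) ∧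
    Tendsto (fun n => star (a n) e) atTop (𝓝 w)

lemma ConjRel.symm {e v w : H} (h : ConjRel D e v w) : ConjRel D e w v := by
  obtain ⟨a, ha, h1, h2⟩ := h
  exact ⟨fun n => star (a n), fun n => star_mem (ha n), h2, by simpa using h1⟩

lemma conjRel_apply {A : B H} (hA : A ∈ D) (e : H) : ConjRel D e (A e) (star A e) :=
  ⟨fun _ => A, fun _ => hA, tendsto_const_nhds, tendsto_const_nhds⟩

lemma ConjRel.right_mem {e v w : H} (h : ConjRel D e v w) : w ∈ cyclicSubspace D e := by
  obtain ⟨a, ha, -, h2⟩ := h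
  exact (Submodule.isClosed_topologicalClosure _).mem_of_tendsto h2
    (Eventually.of_forall fun n => apply_mem_cyclicSubspace (star_mem (ha n)) e)

lemma IsMasa.norm_star_apply (hD : IsMasa D) {A : B H} (hA : A ∈ D) (e : H) :
    ‖star A e‖ = ‖A e‖ := by
  have h : ⟪star A e, star A e⟫_ℂ = ⟪A e, A e⟫_ℂ := by
    rw [inner_star_apply, ← inner_apply_star]
    have := congrArg (fun T : B H => ⟪e, T e⟫_ℂ) (hD.1 A hA (star A) (star_mem hA))
    simpa [mul_apply_eq_comp] using this
  rw [inner_self_eq_norm_sq_to_K, inner_self_eq_norm_sq_to_K] at h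
  exact (sq_eq_sq₀ (norm_nonneg _) (norm_nonneg _)).1 (by exact_mod_cast h)

lemma ConjRel.norm_eq (hD : IsMasa D) {e v w : H} (h : ConjRel D e v w) : ‖w‖ = ‖v‖ := by
  obtain ⟨a, ha, h1, h2⟩ := h
  refine tendsto_nhds_unique h2.norm ?_
  simpa only [hD.norm_star_apply (ha _)] using h1.norm

lemma IsMasa.exists_conjRel (hD : IsMasa D) {e v : H} (hv : v ∈ cyclicSubspace D e) :
    ∃ w, ConjRel D e v w := by
  obtain ⟨a, ha, hlim⟩ := exists_seq_of_mem_cyclicSubspace hv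
  have hc : CauchySeq fun n => star (a n) e := by
    have hc' := hlim.cauchySeq
    rw [Metric.cauchySeq_iff] at hc' ⊢
    simpa only [dist_eq_norm, ← sub_apply, ← star_sub,
      hD.norm_star_apply (sub_mem (ha _) (ha _))] using hc'
  obtain ⟨w, hw⟩ := cauchySeq_tendsto_of_complete hc
  exact ⟨w, a, ha, hlim, hw⟩

lemma ConjRel.inner_apply_eq (hD : IsMasa D) {e v w v' w' : H} (h : ConjRel D e v w)
    (h' : ConjRel D e v' w') {A : B H} (hA : A ∈ D) : ⟪w, A v'⟫_ℂ = ⟪w', A v⟫_ℂ := by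
  obtain ⟨a, ha, h1, h2⟩ := h
  obtain ⟨c, hc, h3, h4⟩ := h'
  refine tendsto_nhds_unique (h2.inner ((A.continuous.tendsto v').comp h3)) ?_
  refine (h4.inner ((A.continuous.tendsto v).comp h1)).congr fun n => ?_
  have h5 : c n * (A * a n) = a n * (A * c n) := by
    rw [hD.1 _ (hc n) _ (mul_mem hA (ha n)), hD.1 A hA _ (ha n), mul_assoc]
  have := congrArg (fun T : B H => ⟪e, T e⟫_ℂ) h5
  simpa only [Function.comp_apply, inner_star_apply, mul_apply_eq_comp] using! this

lemma ConjRel.inner_eq (hD : IsMasa D) {e v w v' w' : H} (h : ConjRel D e v w)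
    (h' : ConjRel D e v' w') : ⟪w, v'⟫_ℂ = ⟪w', v⟫_ℂ :=
  h.inner_apply_eq hD h' (one_mem D)

lemma mul_rankOne_mul (A C : B H) (u v : H) :
    A * rankOne ℂ u v * C = rankOne ℂ (A u) (star C v) := by
  ext z
  simp [inner_star_apply]

lemma starProjection_mul_rankOne_mul {K L : Submodule ℂ H} [K.HasOrthogonalProjection]
    [L.HasOrthogonalProjection] {u v : H} (hu : u ∈ K) (hv : v ∈ L) :
    K.starProjection * rankOne ℂ u v * L.starProjection = rankOne ℂ u v := by
  rw [mul_rankOne_mul, (isSelfAdjoint_starProjection L).star_eq,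
    Submodule.starProjection_eq_self_iff.2 hu, Submodule.starProjection_eq_self_iff.2 hv]

/-- An operator supported on cyclic subspaces is determined by its matrix coefficients
on the generating vectors. -/
lemma eq_zero_of_inner_cyclic {e f : H} {N : B H}
    (hN : (cyclicSubspace D e).starProjection * N * (cyclicSubspace D f).starProjection = N)
    (h : ∀ a ∈ D, ∀ b ∈ D, ⟪b e, N (a f)⟫_ℂ = 0) : N = 0 := by
  have key : ∀ u ∈ cyclicSubspace D f, ∀ v ∈ cyclicSubspace D e, ⟪v, N u⟫_ℂ = 0 := by
    intro u hu v hv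
    obtain ⟨a, ha, hau⟩ := exists_seq_of_mem_cyclicSubspace hu
    obtain ⟨b, hb, hbv⟩ := exists_seq_of_mem_cyclicSubspace hv
    refine tendsto_nhds_unique (hbv.inner ((N.continuous.tendsto u).comp hau)) ?_
    simp [h _ (ha _) _ (hb _)]
  refine ContinuousLinearMap.ext fun u => ext_inner_left ℂ fun v => ?_
  rw [← hN]
  simp only [mul_apply_eq_comp, ← Submodule.inner_starProjection_left_eq_right]
  simpa using key _ (Submodule.starProjection_apply_mem _ u) _
    (Submodule.starProjection_apply_mem _ v)

/-- A Schur multiplier is described, on the rank-one operator `e f*`, by the conjugates of the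
vectors representing its vector functional at `e`, `f`. -/
lemma IsSchurMultiplier.exists_rep (hD : IsMasa D) {Φ : B H →L[ℂ] B H}
    (hΦ : IsSchurMultiplier D Φ) (e f : H) :
    ∃ (ι : Type) (x y p q : ι → H), (∀ i, ConjRel D e (p i) (y i)) ∧
      (∀ i, ConjRel D f (x i) (q i)) ∧ (Summable fun i => ‖y i‖ * ‖x i‖) ∧
      (∀ T : B H, ⟪e, Φ T f⟫_ℂ = ∑' i, ⟪y i, T (x i)⟫_ℂ) ∧
      HasSum (fun i => rankOne ℂ (p i) (q i)) (Φ (rankOne ℂ e f)) := by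
  obtain ⟨ι, x, y, hs, hω⟩ := hΦ.1.hasTraceRep e f
  set P := (cyclicSubspace D e).starProjection with hP
  set Q := (cyclicSubspace D f).starProjection with hQ
  have hPD : P ∈ D := hD.starProjection_mem e
  have hQD : Q ∈ D := hD.starProjection_mem f
  have hPe : P e = e := Submodule.starProjection_eq_self_iff.2 (self_mem_cyclicSubspace e)
  have hQf : Q f = f := Submodule.starProjection_eq_self_iff.2 (self_mem_cyclicSubspace f)
  have hPs : ∀ u v, ⟪P u, v⟫_ℂ = ⟪u, P v⟫_ℂ := Submodule.inner_starProjection_left_eq_right _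
  choose p hp using fun i => hD.exists_conjRel
    (Submodule.starProjection_apply_mem (cyclicSubspace D e) (y i))
  choose q hq using fun i => hD.exists_conjRel
    (Submodule.starProjection_apply_mem (cyclicSubspace D f) (x i))
  have hs' : Summable fun i => ‖P (y i)‖ * ‖Q (x i)‖ :=
    Summable.of_nonneg_of_le (fun _ => by positivity)
      (fun i => mul_le_mul (Submodule.norm_starProjection_apply_le _ _)
        (Submodule.norm_starProjection_apply_le _ _) (norm_nonneg _) (norm_nonneg _)) hs
  have hω' : ∀ T : B H, ⟪e, Φ T f⟫_ℂ = ∑' i, ⟪P (y i), T (Q (x i))⟫_ℂ := fun T => by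
    have h : ⟪e, Φ (P * T * Q) f⟫_ℂ = _ := hω (P * T * Q)
    rw [hΦ.2 P hPD Q hQD T] at h
    simpa only [mul_apply_eq_comp, ← hPs, hPe, hQf] using h
  have hsum : Summable fun i => rankOne ℂ (p i) (q i) :=
    Summable.of_norm_bounded hs' fun i => by
      rw [norm_rankOne, (hp i).norm_eq hD, (hq i).norm_eq hD]
  refine ⟨ι, fun i => Q (x i), fun i => P (y i), p, q, fun i => (hp i).symm, hq, hs', hω', ?_⟩
  suffices h0 : Φ (rankOne ℂ e f) - ∑' i, rankOne ℂ (p i) (q i) = 0 by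
    rw [sub_eq_zero.1 h0]
    exact hsum.hasSum
  refine eq_zero_of_inner_cyclic (D := D) (e := e) (f := f) ?_ fun a ha b hb => ?_
  · rw [← hP, ← hQ, mul_sub, sub_mul, ← hΦ.2 P hPD Q hQD, starProjection_mul_rankOne_mul
      (self_mem_cyclicSubspace e) (self_mem_cyclicSubspace f),
      ← hsum.tsum_mul_left, ← (hsum.mul_left P).tsum_mul_right]
    congr 1
    exact tsum_congr fun i => starProjection_mul_rankOne_mul (hp i).right_mem (hq i).right_mem
  · have h1 := hω' (star b * rankOne ℂ e f * a)
    rw [hΦ.2 _ (star_mem hb) _ ha, mul_rankOne_mul] at h1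
    have h2 : ⟪b e, (∑' i, rankOne ℂ (p i) (q i)) (a f)⟫_ℂ
        = ∑' i, ⟪b e, rankOne ℂ (p i) (q i) (a f)⟫_ℂ :=
      (((innerSL ℂ (b e)) ∘L (ContinuousLinearMap.apply ℂ H (a f))).hasSum
        hsum.hasSum).tsum_eq.symm
    rw [sub_apply, inner_sub_right, h2, sub_eq_zero]
    simp only [mul_apply_eq_comp, inner_apply_star] at h1
    rw [h1]
    refine tsum_congr fun i => ?_
    have h3 := (hp i).symm.inner_eq hD (conjRel_apply (star_mem hb) e)
    rw [star_star] at h3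
    rw [inner_right_rankOne_apply, inner_right_rankOne_apply, h3,
      (hq i).inner_eq hD (conjRel_apply ha f)]

/-- Schur multipliers over a masa commute. -/
theorem IsSchurMultiplier.comp_comm (hD : IsMasa D) {Φ Ψ : B H →L[ℂ] B H}
    (hΦ : IsSchurMultiplier D Φ) (hΨ : IsSchurMultiplier D Ψ) : Φ.comp Ψ = Ψ.comp Φ := by
  refine (hΦ.1.comp hΨ.1).ext_rankOne (hΨ.1.comp hΦ.1) fun e f => ?_
  obtain ⟨ι, x, y, p, q, hpy, hxq, hs, hω, hK⟩ := hΦ.exists_rep hD e f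
  obtain ⟨κ, x', y', p', q', hpy', hxq', hs', hω', hK'⟩ := hΨ.exists_rep hD e f
  have expand : ∀ {ι : Type} {p q : ι → H} {K : B H},
      HasSum (fun i => rankOne ℂ (p i) (q i)) K → ∀ (a b : B H) (u v : H),
      ⟪u, (star b * K * a) v⟫_ℂ = ∑' i, ⟪b u, p i⟫_ℂ * ⟪q i, a v⟫_ℂ := by
    intro ι p q K hK a b u v
    have := (((innerSL ℂ (b u)) ∘L (ContinuousLinearMap.apply ℂ H (a v))).hasSum hK).tsum_eq
    simpa [inner_apply_star, mul_comm] using this.symm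
  have coeff : ∀ {Θ : B H →L[ℂ] B H} {ι κ : Type} {x y : ι → H} {p q : κ → H} {K : B H},
      IsSchurMultiplier D Θ → (∀ T : B H, ⟪e, Θ T f⟫_ℂ = ∑' i, ⟪y i, T (x i)⟫_ℂ) →
      HasSum (fun j => rankOne ℂ (p j) (q j)) K → ∀ a ∈ D, ∀ b ∈ D,
      ⟪b e, Θ K (a f)⟫_ℂ = ∑' i, ∑' j, ⟪b (y i), p j⟫_ℂ * ⟪q j, a (x i)⟫_ℂ := by
    intro Θ ι κ x y p q K hΘ hω hK a ha b hb
    have h := hω (star b * K * a)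
    rw [hΘ.2 _ (star_mem hb) _ ha] at h
    simp only [expand hK] at h
    rw [← h, mul_apply_eq_comp, mul_apply_eq_comp, inner_apply_star]
  have hsupp := starProjection_mul_rankOne_mul (self_mem_cyclicSubspace (D := D) e)
    (self_mem_cyclicSubspace (D := D) f)
  have hPD := hD.starProjection_mem e
  have hQD := hD.starProjection_mem f
  rw [← sub_eq_zero, ContinuousLinearMap.comp_apply, ContinuousLinearMap.comp_apply]
  refine eq_zero_of_inner_cyclic (D := D) (e := e) (f := f) ?_ fun a ha b hb => ?_
  · rw [mul_sub, sub_mul, ← hΦ.2 _ hPD _ hQD, ← hΨ.2 _ hPD _ hQD, ← hΨ.2 _ hPD _ hQD,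
      ← hΦ.2 _ hPD _ hQD, hsupp]
  rw [sub_apply, inner_sub_right, sub_eq_zero, coeff hΦ hω hK' a ha b hb,
    coeff hΨ hω' hK a ha b hb]
  have hswap : ∀ i j, ⟪b (y i), p' j⟫_ℂ * ⟪q' j, a (x i)⟫_ℂ
      = ⟪b (y' j), p i⟫_ℂ * ⟪q i, a (x' j)⟫_ℂ := fun i j => by
    rw [← inner_apply_star, ← inner_apply_star,
      (hpy i).inner_apply_eq hD (hpy' j) (star_mem hb),
      (hxq' j).inner_apply_eq hD (hxq i) ha]
  simp only [← hswap]
  refine (Summable.tsum_comm (Summable.of_norm_bounded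
    ((hs.mul_of_nonneg hs' (fun _ => by positivity) fun _ => by positivity).mul_left
      (‖b‖ * ‖a‖)) fun ⟨i, j⟩ => ?_)).symm
  calc ‖⟪b (y i), p' j⟫_ℂ * ⟪q' j, a (x i)⟫_ℂ‖
      ≤ (‖b (y i)‖ * ‖p' j‖) * (‖q' j‖ * ‖a (x i)‖) := by
        rw [norm_mul]
        exact mul_le_mul (norm_inner_le_norm _ _) (norm_inner_le_norm _ _) (norm_nonneg _)
          (by positivity)
    _ ≤ ((‖b‖ * ‖y i‖) * ‖y' j‖) * (‖x' j‖ * (‖a‖ * ‖x i‖)) := by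
        rw [← (hpy' j).norm_eq hD, (hxq' j).norm_eq hD]
        gcongr
        · exact b.le_opNorm _
        · exact a.le_opNorm _
    _ = ‖b‖ * ‖a‖ * ((‖y i‖ * ‖x i‖) * (‖y' j‖ * ‖x' j‖)) := by ring

/-- The composition of two Schur idempotents over a masa is a Schur idempotent. -/
lemma IsSchurIdempotent.comp (hD : IsMasa D) {Φ Ψ : B H →L[ℂ] B H}
    (hΦ : IsSchurIdempotent D Φ) (hΨ : IsSchurIdempotent D Ψ) :
    IsSchurIdempotent D (Φ.comp Ψ) := by
  refine ⟨⟨hΦ.1.1.comp hΨ.1.1, fun A hA C hC T => ?_⟩, ?_⟩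
  · rw [ContinuousLinearMap.comp_apply, hΨ.1.2 A hA C hC, hΦ.1.2 A hA C hC,
      ContinuousLinearMap.comp_apply]
  · calc (Φ.comp Ψ).comp (Φ.comp Ψ) = Φ.comp ((Ψ.comp Φ).comp Ψ) := rfl
      _ = Φ.comp ((Φ.comp Ψ).comp Ψ) := by rw [hΦ.1.comp_comm hD hΨ.1]
      _ = (Φ.comp Φ).comp (Ψ.comp Ψ) := rfl
      _ = Φ.comp Ψ := by rw [hΦ.2, hΨ.2]

lemma IsSchurIdempotent.range_comp (hD : IsMasa D) {Φ Ψ : B H →L[ℂ] B H}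
    (hΦ : IsSchurIdempotent D Φ) (hΨ : IsSchurIdempotent D Ψ) :
    Set.range ⇑(Φ.comp Ψ) = Set.range ⇑Φ ∩ Set.range ⇑Ψ := by
  ext T
  constructor
  · rintro ⟨S, rfl⟩
    exact ⟨⟨Ψ S, rfl⟩, ⟨Φ S, (DFunLike.congr_fun (hΦ.1.comp_comm hD hΨ.1) S).symm⟩⟩
  · rintro ⟨⟨R, rfl⟩, ⟨S, hS⟩⟩
    refine ⟨Φ R, ?_⟩
    have h1 : Ψ (Φ R) = Φ R := by
      rw [← hS]
      exact DFunLike.congr_fun hΨ.2 S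
    rw [ContinuousLinearMap.comp_apply, h1]
    exact DFunLike.congr_fun hΦ.2 R

lemma add_mul_norm_mem_lamSet (hD : IsMasa D) {Φ Ψ : B H →L[ℂ] B H}
    (hΦ : IsSchurIdempotent D Φ) (hΨ : IsSchurIdempotent D Ψ) {k l : ℝ}
    (hk : k ∈ lamSet Φ) (hl : l ∈ lamSet Ψ) : k + l * ‖Φ‖ ∈ lamSet (Φ.comp Ψ) := by
  have hr := hΦ.range_comp hD hΨ
  have h0 : (0 : B H) ∈ Set.range (Φ.comp Ψ) := ⟨0, map_zero _⟩
  refine ⟨add_pos_of_pos_of_nonneg hk.1 (mul_nonneg hl.1.le (norm_nonneg _)), fun T => ?_⟩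
  have h1 : arveson T (Set.range Φ) ≤ arveson T (Set.range (Φ.comp Ψ)) :=
    arveson_anti h0 (hr ▸ Set.inter_subset_left) T
  have h2 : arveson T (Set.range Ψ) ≤ arveson T (Set.range (Φ.comp Ψ)) :=
    arveson_anti h0 (hr ▸ Set.inter_subset_right) T
  calc ‖T - Φ.comp Ψ T‖ = ‖(T - Φ T) + Φ (T - Ψ T)‖ := by simp
    _ ≤ ‖T - Φ T‖ + ‖Φ‖ * ‖T - Ψ T‖ :=
      (norm_add_le _ _).trans (by gcongr; exact Φ.le_opNorm _)
    _ ≤ k * arveson T (Set.range (Φ.comp Ψ)) +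
        ‖Φ‖ * (l * arveson T (Set.range (Φ.comp Ψ))) := by
      gcongr
      · exact (hk.2 T).trans (mul_le_mul_of_nonneg_left h1 hk.1.le)
      · exact (hl.2 T).trans (mul_le_mul_of_nonneg_left h2 hl.1.le)
    _ = _ := by ring

end

end SchurHyper

/-- if `Φ₁, Φ₂ ∈ 𝔉H`, then the Schur idempotent `Φ₁∘Φ₂` (whose
range is `ran Φ₁ ∩ ran Φ₂`) belongs to `𝔉H`, with
`λ(Φ₁∘Φ₂) ≤ λ(Φ₁) + λ(Φ₂)·‖Φ₁‖`. -/
theorem stmt4 {H : Type*} [NormedAddCommGroup H] [InnerProductSpace ℂ H] [CompleteSpace H]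
    [TopologicalSpace.SeparableSpace H]
    (D : StarSubalgebra ℂ (B H)) (hD : IsMasa D)
    (Φ₁ Φ₂ : B H →L[ℂ] B H) (h₁ : MemFH D Φ₁) (h₂ : MemFH D Φ₂) :
    Set.range ⇑(Φ₁.comp Φ₂) = Set.range ⇑Φ₁ ∩ Set.range ⇑Φ₂ ∧
    MemFH D (Φ₁.comp Φ₂) ∧
    lam (Φ₁.comp Φ₂) ≤ lam Φ₁ + lam Φ₂ * ‖Φ₁‖ := by
  have hmem := fun k (hk : k ∈ lamSet Φ₁) l (hl : l ∈ lamSet Φ₂) =>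
    add_mul_norm_mem_lamSet hD h₁.1 h₂.1 hk hl
  obtain ⟨k₀, hk₀⟩ := h₁.2
  obtain ⟨l₀, hl₀⟩ := h₂.2
  refine ⟨h₁.1.range_comp hD h₂.1, ⟨h₁.1.comp hD h₂.1, _, hmem k₀ hk₀ l₀ hl₀⟩, ?_⟩
  have hle : ∀ k ∈ lamSet Φ₁, ∀ l ∈ lamSet Φ₂, lam (Φ₁.comp Φ₂) ≤ k + l * ‖Φ₁‖ :=
    fun k hk l hl => csInf_le ⟨0, fun _ h => h.1.le⟩ (hmem k hk l hl)
  have hle' : ∀ l ∈ lamSet Φ₂, lam (Φ₁.comp Φ₂) ≤ lam Φ₁ + l * ‖Φ₁‖ := fun l hl =>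
    sub_le_iff_le_add.1 <| le_csInf ⟨k₀, hk₀⟩ fun k hk => sub_le_iff_le_add.2 (hle k hk l hl)
  refine le_of_forall_pos_le_add fun ε hε => ?_
  obtain ⟨l, hl, hlt⟩ := exists_lt_of_csInf_lt ⟨l₀, hl₀⟩
    (lt_add_of_pos_right (lam Φ₂) (show 0 < ε / (‖Φ₁‖ + 1) by positivity))
  have h3 : ε / (‖Φ₁‖ + 1) * ‖Φ₁‖ ≤ ε := by
    rw [div_mul_eq_mul_div, div_le_iff₀ (by positivity)]
    nlinarith
  have h4 : l * ‖Φ₁‖ ≤ (lam Φ₂ + ε / (‖Φ₁‖ + 1)) * ‖Φ₁‖ :=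
    mul_le_mul_of_nonneg_right hlt.le (norm_nonneg _)
  linarith [hle' l hl]
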